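/- Let d ≥ 1, let V : ℝ^d → ℝ be Borel measurable and let x, y ∈ ℝ^d. Then the map t ↦ S(V,t,x,y) ∈ [0,∞] is lower semicontinuous on the left: for every t > 0, S(V,t,x,y) ≤ liminf_{ε → 0+} S(V, t-ε, x, y). -/

import Mathlib

open MeasureTheory Real Filter
open scoped ENNReal Topology

/-- The Gauss–Weierstrass kernel `g_d(t,x,y) = (4πt)^{-d/2} exp(-|y-x|²/(4t))` on `ℝ^d`. -/
noncomputable def gwk (d : ℕ) (t : ℝ) (x y : EuclideanSpace ℝ (Fin d)) : ℝ :=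
  (4 * Real.pi * t) ^ (-(d : ℝ) / 2) * Real.exp (-‖y - x‖ ^ 2 / (4 * t))

/-- `S(V,t,x,y) = ∫₀^t ∫_{ℝ^d} (g_d(s,x,z) g_d(t-s,z,y)/g_d(t,x,y)) |V(z)| dz ds ∈ [0,∞]`. -/
noncomputable def Sq (d : ℕ) (V : EuclideanSpace ℝ (Fin d) → ℝ) (t : ℝ)
    (x y : EuclideanSpace ℝ (Fin d)) : ℝ≥0∞ :=
  ∫⁻ s in Set.Ioo (0 : ℝ) t, ∫⁻ z,
    ENNReal.ofReal (gwk d s x z * gwk d (t - s) z y / gwk d t x y * |V z|)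

/-- The bridge operator `T^{t,y}_s f (x)`. -/
noncomputable def bridgeOp (d : ℕ) (t s : ℝ) (y : EuclideanSpace ℝ (Fin d))
    (f : EuclideanSpace ℝ (Fin d) → ℝ) (x : EuclideanSpace ℝ (Fin d)) : ℝ :=
  ∫ z, gwk d s x z * gwk d (t - s) z y / gwk d t x y * f z

/-- The constant `C(d,p)`. -/
noncomputable def Cconst (d : ℕ) (p : ℝ) : ℝ :=
  if p = 1 then (4 * Real.pi) ^ (-(d : ℝ) / 2)
  else (4 * Real.pi) ^ (-(d : ℝ) / (2 * p)) * (1 - p⁻¹) ^ ((1 - p⁻¹) * (d : ℝ) / 2)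

lemma measurable_gwk {α : Type*} [MeasurableSpace α] (d : ℕ) {τ : α → ℝ}
    {u v : α → EuclideanSpace ℝ (Fin d)} (hτ : Measurable τ) (hu : Measurable u)
    (hv : Measurable v) : Measurable fun a => gwk d (τ a) (u a) (v a) := by
  unfold gwk
  fun_prop

lemma continuousAt_gwk (d : ℕ) (x y : EuclideanSpace ℝ (Fin d)) {t : ℝ} (ht : 0 < t) :
    ContinuousAt (fun τ => gwk d τ x y) t := by
  unfold gwk
  refine ContinuousAt.mul (ContinuousAt.rpow_const (by fun_prop) (Or.inl (by positivity))) ?_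
  exact Real.continuous_exp.continuousAt.comp
    (continuousAt_const.div (by fun_prop) (by positivity))

lemma gwk_pos (d : ℕ) (x y : EuclideanSpace ℝ (Fin d)) {t : ℝ} (ht : 0 < t) :
    0 < gwk d t x y := by
  unfold gwk
  positivity

/-- The integrand of `Sq` depends continuously on the final time. -/
lemma continuousAt_bridge_integrand (d : ℕ) (c : ℝ) (x y z : EuclideanSpace ℝ (Fin d))
    {s t : ℝ} (hs : 0 < s) (hst : s < t) :
    ContinuousAt (fun τ => ENNReal.ofReal
      (gwk d s x z * gwk d (τ - s) z y / gwk d τ x y * c)) t := by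
  have hz : ContinuousAt (fun τ => gwk d (τ - s) z y) t :=
    ContinuousAt.comp (f := fun τ : ℝ => τ - s) (g := fun τ => gwk d τ z y)
      (continuousAt_gwk d z y (sub_pos.2 hst)) (by fun_prop)
  have ht : 0 < t := hs.trans hst
  exact ENNReal.continuous_ofReal.continuousAt.comp
    (((continuousAt_const.mul hz).div (continuousAt_gwk d x y ht)
      (gwk_pos d x y ht).ne').mul continuousAt_const)

lemma measurable_bridge_integrand (d : ℕ) {V : EuclideanSpace ℝ (Fin d) → ℝ} (hV : Measurable V)
    (x y : EuclideanSpace ℝ (Fin d)) (t : ℝ) :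
    Measurable fun p : ℝ × EuclideanSpace ℝ (Fin d) => ENNReal.ofReal
      (gwk d p.1 x p.2 * gwk d (t - p.1) p.2 y / gwk d t x y * |V p.2|) := by
  have h₁ : Measurable fun p : ℝ × EuclideanSpace ℝ (Fin d) => gwk d p.1 x p.2 :=
    measurable_gwk d measurable_fst measurable_const measurable_snd
  have h₂ : Measurable fun p : ℝ × EuclideanSpace ℝ (Fin d) => gwk d (t - p.1) p.2 y :=
    measurable_gwk d (by fun_prop) measurable_snd measurable_const
  have h₃ : Measurable fun p : ℝ × EuclideanSpace ℝ (Fin d) => |V p.2| :=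
    (hV.comp measurable_snd).norm
  exact (((h₁.mul h₂).div_const _).mul h₃).ennreal_ofReal

/-- `t ↦ S(V,t,x,y)` is lower semicontinuous on the left:
`S(V,t,x,y) ≤ liminf_{ε→0+} S(V,t-ε,x,y)`. -/
theorem stmt17 (d : ℕ) (hd : 1 ≤ d) (V : EuclideanSpace ℝ (Fin d) → ℝ) (hV : Measurable V)
    (x y : EuclideanSpace ℝ (Fin d)) (t : ℝ) (ht : 0 < t) :
    Sq d V t x y ≤ liminf (fun ε : ℝ => Sq d V (t - ε) x y) (𝓝[>] 0) := by
  have htend : Tendsto (fun ε : ℝ => t - ε) (𝓝[>] 0) (𝓝 t) := by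
    have h : Tendsto (fun ε : ℝ => t - ε) (𝓝 0) (𝓝 (t - 0)) :=
      (continuous_const.sub continuous_id).tendsto 0
    rw [sub_zero] at h
    exact h.mono_left nhdsWithin_le_nhds
  have hm := measurable_bridge_integrand d hV x y
  simp only [Sq, ← lintegral_indicator measurableSet_Ioo]
  refine le_trans (lintegral_mono fun s => ?_) (lintegral_liminf_le fun ε =>
    ((hm (t - ε)).lintegral_prod_right').indicator measurableSet_Ioo)
  by_cases hs : s ∈ Set.Ioo 0 t
  · rw [Set.indicator_of_mem hs]
    have hev : ∀ᶠ ε in 𝓝[>] (0 : ℝ), s < t - ε := htend.eventually (lt_mem_nhds hs.2)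
    have hslice : ∀ ε : ℝ, Measurable fun z => ENNReal.ofReal
        (gwk d s x z * gwk d (t - ε - s) z y / gwk d (t - ε) x y * |V z|) := fun ε => by
      have h := (hm (t - ε)).comp (measurable_prodMk_left (x := s))
      simpa only [Function.comp_def] using h
    have hlim : ∀ z, liminf (fun ε => ENNReal.ofReal
        (gwk d s x z * gwk d (t - ε - s) z y / gwk d (t - ε) x y * |V z|)) (𝓝[>] 0) =
        ENNReal.ofReal (gwk d s x z * gwk d (t - s) z y / gwk d t x y * |V z|) := fun z =>
      ((continuousAt_bridge_integrand d |V z| x y z hs.1 hs.2).tendsto.comp htend).liminf_eq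
    simp only [← hlim]
    refine (lintegral_liminf_le hslice).trans_eq (liminf_congr (hev.mono fun ε h => ?_))
    rw [Set.indicator_of_mem (s := Set.Ioo 0 (t - ε)) ⟨hs.1, h⟩]
  · simp [Set.indicator_of_notMem hs]
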